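/- For every real β ≥ 1, every real h with 0 ≤ h < h_w(β) = log(e^{4β}/(e^{4β}−1)), every real δ > 0 and every integer N ≥ 1, letting κ = (4β + δ)/log(e^{−h} + e^{−4β}), one has P_N^{β,h}( {φ ∈ Ω_N : |φ^{−1}(0)| ≥ κ N} ) ≤ e^{−δ N}. -/

import Mathlib

open Real Finset
open scoped Classical

noncomputable section

/-- The box `Λ_N = {1,…,N}²` in `ℤ²`. -/
def Lam (N : ℕ) : Finset (ℤ × ℤ) := Finset.Icc (1:ℤ) (N:ℤ) ×ˢ Finset.Icc (1:ℤ) (N:ℤ)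

/-- The four nearest neighbors of a site of `ℤ²`. -/
def nbrs (x : ℤ × ℤ) : Finset (ℤ × ℤ) :=
  {(x.1 + 1, x.2), (x.1 - 1, x.2), (x.1, x.2 + 1), (x.1, x.2 - 1)}

/-- An enlarged box containing all edges touching `Λ_N`. -/
def Box (N : ℕ) : Finset (ℤ × ℤ) := Finset.Icc (0:ℤ) ((N:ℤ)+1) ×ˢ Finset.Icc (0:ℤ) ((N:ℤ)+1)

/-- The SOS Hamiltonian with zero boundary conditions, for fields vanishing outside `Λ_N`:
each edge `{x,y}` with `x ~ y` touching `Λ_N` is counted twice in the double sum (once from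
each endpoint, both endpoints lying in `Box N`), whence the factor `1/2`.  Since the field
vanishes outside `Λ_N`, this equals
`Σ_{{x,y}⊂Λ_N, x~y} |φ(x)−φ(y)| + Σ_{x∈Λ_N, y∉Λ_N, x~y} |φ(x)|`. -/
def Ham (N : ℕ) (φ : ℤ × ℤ → ℤ) : ℝ :=
  (1/2) * ∑ x ∈ Box N, ∑ y ∈ nbrs x, |(φ x : ℝ) - (φ y : ℝ)|

/-- The level set `φ⁻¹(k)` inside `Λ_N`. -/
def levelSet (N : ℕ) (φ : ℤ × ℤ → ℤ) (k : ℤ) : Finset (ℤ × ℤ) :=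
  (Lam N).filter fun x => φ x = k

/-- The configuration space `Ω_N`: nonnegative integer fields vanishing outside `Λ_N`. -/
def Conf (N : ℕ) : Type :=
  {φ : ℤ × ℤ → ℤ // (∀ x, 0 ≤ φ x) ∧ ∀ x ∉ Lam N, φ x = 0}

/-- The Boltzmann weight `exp(−β H_N(φ) + h |φ⁻¹(0)|)`. -/
def weight (N : ℕ) (β h : ℝ) (φ : ℤ × ℤ → ℤ) : ℝ :=
  Real.exp (-β * Ham N φ + h * ((levelSet N φ 0).card : ℝ))

/-- The partition function `Z_N^{β,h}`. -/
def Z (N : ℕ) (β h : ℝ) : ℝ := ∑' φ : Conf N, weight N β h φ.val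

/-- The probability of an event `E ⊆ Ω_N` under `P_N^{β,h}`. -/
def prob (N : ℕ) (β h : ℝ) (E : Set (Conf N)) : ℝ :=
  (∑' φ : Conf N, if φ ∈ E then weight N β h φ.val else 0) / Z N β h

/-- The critical pinning value `h_w(β) = log(e^{4β}/(e^{4β}−1))`. -/
def hw (β : ℝ) : ℝ := Real.log (Real.exp (4*β) / (Real.exp (4*β) - 1))

/-- The indicator function of a set of sites, as an integer field. -/
def siteInd (S : Finset (ℤ × ℤ)) (x : ℤ × ℤ) : ℤ := if x ∈ S then 1 else 0

theorem sum_nbrs (x : ℤ × ℤ) (f : ℤ × ℤ → ℝ) :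
    ∑ y ∈ nbrs x, f y =
      f (x.1 + 1, x.2) + f (x.1 - 1, x.2) + f (x.1, x.2 + 1) + f (x.1, x.2 - 1) := by
  unfold nbrs
  rw [Finset.sum_insert, Finset.sum_insert, Finset.sum_insert, Finset.sum_singleton]
  · ring
  all_goals
    simp only [Finset.mem_insert, Finset.mem_singleton, Prod.mk.injEq]
    omega

theorem card_nbrs (x : ℤ × ℤ) : ((nbrs x).card : ℝ) = 4 := by
  have := sum_nbrs x fun _ => 1
  norm_num at this
  exact this

theorem mem_nbrs_comm {x y : ℤ × ℤ} : y ∈ nbrs x ↔ x ∈ nbrs y := by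
  obtain ⟨a, b⟩ := x
  obtain ⟨c, d⟩ := y
  simp only [nbrs, Finset.mem_insert, Finset.mem_singleton, Prod.mk.injEq]
  omega

theorem Ham_add_sub_le (N : ℕ) (φ f g : ℤ × ℤ → ℤ) :
    Ham N (fun x => φ x + f x - g x) ≤ Ham N φ + Ham N f + Ham N g := by
  unfold Ham
  rw [← mul_add, ← mul_add, ← Finset.sum_add_distrib, ← Finset.sum_add_distrib]
  refine mul_le_mul_of_nonneg_left (Finset.sum_le_sum fun x _ => ?_) (by norm_num)
  rw [← Finset.sum_add_distrib, ← Finset.sum_add_distrib]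
  refine Finset.sum_le_sum fun y _ => ?_
  push_cast
  calc |(φ x + f x - g x : ℝ) - (φ y + f y - g y)|
      = |((φ x - φ y : ℝ) + (f x - f y)) - (g x - g y)| := by congr 1; ring
    _ ≤ |(φ x - φ y : ℝ) + (f x - f y)| + |(g x - g y : ℝ)| := abs_sub _ _
    _ ≤ _ := by gcongr; exact abs_add_le _ _

theorem Ham_siteInd_le (N : ℕ) (A : Finset (ℤ × ℤ)) :
    Ham N (siteInd A) ≤ 4 * (A.card : ℝ) := by
  have key : ∀ x y : ℤ × ℤ, |(siteInd A x : ℝ) - (siteInd A y : ℝ)| ≤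
      (if x ∈ A then 1 else 0) + (if y ∈ A then 1 else 0) := by
    intro x y
    unfold siteInd
    split_ifs <;> norm_num
  have h1 : ∑ x ∈ Box N, ∑ y ∈ nbrs x, (if x ∈ A then (1 : ℝ) else 0) ≤ 4 * (A.card : ℝ) := by
    calc ∑ x ∈ Box N, ∑ y ∈ nbrs x, (if x ∈ A then (1 : ℝ) else 0)
        = 4 * ∑ x ∈ Box N, (if x ∈ A then (1 : ℝ) else 0) := by
          simp only [Finset.sum_const, nsmul_eq_mul, card_nbrs, Finset.mul_sum]
      _ ≤ 4 * (A.card : ℝ) := by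
          rw [Finset.sum_boole]
          gcongr
          exact fun x hx => (Finset.mem_filter.1 hx).2
  have h2 : ∑ x ∈ Box N, ∑ y ∈ nbrs x, (if y ∈ A then (1 : ℝ) else 0) ≤ 4 * (A.card : ℝ) := by
    calc ∑ x ∈ Box N, ∑ y ∈ nbrs x, (if y ∈ A then (1 : ℝ) else 0)
        = ∑ x ∈ Box N, ∑ y ∈ A, (if x ∈ nbrs y then (1 : ℝ) else 0) := by
          refine Finset.sum_congr rfl fun x _ => ?_
          rw [Finset.sum_boole, Finset.sum_boole]
          congr 2
          ext y
          simp only [Finset.mem_filter, mem_nbrs_comm (x := x) (y := y)]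
          tauto
      _ = ∑ y ∈ A, ∑ x ∈ Box N, (if x ∈ nbrs y then (1 : ℝ) else 0) := Finset.sum_comm
      _ ≤ ∑ y ∈ A, (4 : ℝ) := by
          refine Finset.sum_le_sum fun y _ => ?_
          rw [Finset.sum_boole, ← card_nbrs y]
          gcongr
          exact fun x hx => (Finset.mem_filter.1 hx).2
      _ = 4 * (A.card : ℝ) := by rw [Finset.sum_const, nsmul_eq_mul, mul_comm]
  have h3 : ∑ x ∈ Box N, ∑ y ∈ nbrs x, |(siteInd A x : ℝ) - (siteInd A y : ℝ)| ≤
      4 * (A.card : ℝ) + 4 * (A.card : ℝ) := by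
    refine (Finset.sum_le_sum fun x _ => Finset.sum_le_sum fun y _ => key x y).trans ?_
    simp only [Finset.sum_add_distrib]
    exact add_le_add h1 h2
  unfold Ham
  linarith

theorem sum_abs_siteInd_sub_le (N : ℕ) (τ : ℤ × ℤ → ℤ × ℤ) (S : Finset (ℤ × ℤ))
    (hS : ∀ x, x ∉ S → (x ∈ Lam N ↔ τ x ∈ Lam N)) :
    ∑ x ∈ Box N, |(siteInd (Lam N) x : ℝ) - (siteInd (Lam N) (τ x) : ℝ)| ≤ (S.card : ℝ) := by
  calc ∑ x ∈ Box N, |(siteInd (Lam N) x : ℝ) - (siteInd (Lam N) (τ x) : ℝ)|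
      ≤ ∑ x ∈ Box N, (if x ∈ S then (1 : ℝ) else 0) := by
        refine Finset.sum_le_sum fun x _ => ?_
        by_cases hx : x ∈ S
        · rw [if_pos hx]
          unfold siteInd
          split_ifs <;> norm_num
        · simp [siteInd, hS x hx, hx]
    _ ≤ (S.card : ℝ) := by
        rw [Finset.sum_boole]
        gcongr
        exact fun x hx => (Finset.mem_filter.1 hx).2

theorem card_pair_product_le (N : ℕ) (a b : ℤ) :
    ((({a, b} : Finset ℤ) ×ˢ Finset.Icc (1:ℤ) N).card : ℝ) ≤ 2 * N := by
  rw [Finset.card_product, Int.card_Icc]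
  have := Finset.card_le_two (a := a) (b := b)
  simp only [add_sub_cancel_right, Int.toNat_natCast]
  push_cast
  gcongr
  exact_mod_cast this

theorem card_product_pair_le (N : ℕ) (a b : ℤ) :
    ((Finset.Icc (1:ℤ) N ×ˢ ({a, b} : Finset ℤ)).card : ℝ) ≤ 2 * N := by
  have := card_pair_product_le N a b
  rwa [Finset.card_product, mul_comm, ← Finset.card_product]

theorem Ham_siteInd_Lam_le (N : ℕ) : Ham N (siteInd (Lam N)) ≤ 4 * (N : ℝ) := by
  unfold Ham
  simp only [sum_nbrs, Finset.sum_add_distrib]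
  have h1 := (sum_abs_siteInd_sub_le N (fun x => (x.1 + 1, x.2))
    (({0, (N:ℤ)} : Finset ℤ) ×ˢ Finset.Icc (1:ℤ) N) (by
      intro x hx
      simp only [Lam, Finset.mem_product, Finset.mem_Icc, Finset.mem_insert,
        Finset.mem_singleton] at hx ⊢
      omega)).trans (card_pair_product_le N _ _)
  have h2 := (sum_abs_siteInd_sub_le N (fun x => (x.1 - 1, x.2))
    (({1, (N:ℤ) + 1} : Finset ℤ) ×ˢ Finset.Icc (1:ℤ) N) (by
      intro x hx
      simp only [Lam, Finset.mem_product, Finset.mem_Icc, Finset.mem_insert,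
        Finset.mem_singleton] at hx ⊢
      omega)).trans (card_pair_product_le N _ _)
  have h3 := (sum_abs_siteInd_sub_le N (fun x => (x.1, x.2 + 1))
    (Finset.Icc (1:ℤ) N ×ˢ ({0, (N:ℤ)} : Finset ℤ)) (by
      intro x hx
      simp only [Lam, Finset.mem_product, Finset.mem_Icc, Finset.mem_insert,
        Finset.mem_singleton] at hx ⊢
      omega)).trans (card_product_pair_le N _ _)
  have h4 := (sum_abs_siteInd_sub_le N (fun x => (x.1, x.2 - 1))
    (Finset.Icc (1:ℤ) N ×ˢ ({1, (N:ℤ) + 1} : Finset ℤ)) (by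
      intro x hx
      simp only [Lam, Finset.mem_product, Finset.mem_Icc, Finset.mem_insert,
        Finset.mem_singleton] at hx ⊢
      omega)).trans (card_product_pair_le N _ _)
  linarith

/-- Lift a field by one inside `Λ_N`, except on a set `A` where it is left at height zero. -/
def liftField (N : ℕ) (φ : ℤ × ℤ → ℤ) (A : Finset (ℤ × ℤ)) (x : ℤ × ℤ) : ℤ :=
  if x ∈ Lam N ∧ x ∉ A then φ x + 1 else 0

/-- `liftField` as a map of configurations. -/
def liftConf (N : ℕ) (φ : Conf N) (A : Finset (ℤ × ℤ)) : Conf N :=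
  ⟨liftField N φ.val A, by
    constructor
    · intro x
      unfold liftField
      have := φ.property.1 x
      split_ifs <;> omega
    · intro x hx
      simp [liftField, hx]⟩

theorem levelSet_liftConf {N : ℕ} (φ : Conf N) {A : Finset (ℤ × ℤ)} (hA : A ⊆ Lam N) :
    levelSet N (liftConf N φ A).val 0 = A := by
  ext x
  have h0 := φ.property.1 x
  have hAx := @hA x
  refine Finset.mem_filter.trans ?_
  simp only [liftConf, liftField]
  split_ifs with hx
  · constructor
    · rintro ⟨_, h⟩
      omega
    · exact fun h => absurd h hx.2
  · tauto

theorem liftConf_injOn {N : ℕ} {φ ψ : Conf N} {A B : Finset (ℤ × ℤ)}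
    (hA : A ⊆ levelSet N φ.val 0) (hB : B ⊆ levelSet N ψ.val 0)
    (hlift : liftConf N φ A = liftConf N ψ B) : φ = ψ ∧ A = B := by
  have hAB : A = B := by
    rw [← levelSet_liftConf φ (hA.trans (Finset.filter_subset _ _)), hlift,
      levelSet_liftConf ψ (hB.trans (Finset.filter_subset _ _))]
  subst hAB
  refine ⟨Subtype.ext (funext fun x => ?_), rfl⟩
  by_cases hx : x ∈ Lam N
  · by_cases hxA : x ∈ A
    · rw [(Finset.mem_filter.1 (hA hxA)).2, (Finset.mem_filter.1 (hB hxA)).2]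
    · have := congrFun (congrArg Subtype.val hlift) x
      simpa [liftConf, liftField, hx, hxA] using this
  · rw [φ.property.2 x hx, ψ.property.2 x hx]

theorem Ham_liftConf_le {N : ℕ} (φ : Conf N) {A : Finset (ℤ × ℤ)}
    (hA : A ⊆ levelSet N φ.val 0) :
    Ham N (liftConf N φ A).val ≤ Ham N φ.val + 4 * (N : ℝ) + 4 * (A.card : ℝ) := by
  have heq : (liftConf N φ A).val =
      fun x => φ.val x + siteInd (Lam N) x - siteInd A x := by
    funext x
    simp only [liftConf, liftField, siteInd]
    by_cases hxA : x ∈ A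
    · have := Finset.mem_filter.1 (hA hxA)
      simp [hxA, this.1, this.2]
    · by_cases hx : x ∈ Lam N
      · simp [hxA, hx]
      · simp [hxA, hx, φ.property.2 x hx]
  rw [heq]
  linarith [Ham_add_sub_le N φ.val (siteInd (Lam N)) (siteInd A), Ham_siteInd_le N A,
    Ham_siteInd_Lam_le N]

theorem weight_mul_le_weight_liftConf {N : ℕ} {β : ℝ} (hβ : 0 ≤ β) (h : ℝ) (φ : Conf N)
    {A : Finset (ℤ × ℤ)} (hA : A ⊆ levelSet N φ.val 0) :
    weight N β h φ.val * Real.exp (-4 * β * N) *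
        (Real.exp (-4 * β) ^ A.card *
          Real.exp (-h) ^ ((levelSet N φ.val 0).card - A.card)) ≤
      weight N β h (liftConf N φ A).val := by
  unfold weight
  rw [levelSet_liftConf φ (hA.trans (Finset.filter_subset _ _)), ← Real.exp_nat_mul,
    ← Real.exp_nat_mul, ← Real.exp_add, ← Real.exp_add, ← Real.exp_add,
    Nat.cast_sub (Finset.card_le_card hA)]
  refine Real.exp_le_exp.2 ?_
  have := mul_le_mul_of_nonneg_left (Ham_liftConf_le φ hA) hβ
  linarith

theorem weight_mul_pow_le_sum {N : ℕ} {β : ℝ} (hβ : 0 ≤ β) (h : ℝ) (φ : Conf N) :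
    weight N β h φ.val * Real.exp (-4 * β * N) *
        (Real.exp (-h) + Real.exp (-4 * β)) ^ (levelSet N φ.val 0).card ≤
      ∑ A ∈ (levelSet N φ.val 0).powerset, weight N β h (liftConf N φ A).val := by
  rw [add_comm (Real.exp (-h)), ← Finset.sum_pow_mul_eq_add_pow, Finset.mul_sum]
  exact Finset.sum_le_sum fun A hA =>
    weight_mul_le_weight_liftConf hβ h φ (Finset.mem_powerset.1 hA)

theorem weight_pos (N : ℕ) (β h : ℝ) (φ : ℤ × ℤ → ℤ) : 0 < weight N β h φ := Real.exp_pos _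

theorem sum_liftConf_le_Z {N : ℕ} {β h : ℝ}
    (hs : Summable fun φ : Conf N => weight N β h φ.val) (F : Finset (Conf N)) :
    ∑ φ ∈ F, ∑ A ∈ (levelSet N φ.val 0).powerset, weight N β h (liftConf N φ A).val ≤
      Z N β h := by
  rw [Finset.sum_sigma' F (fun φ => (levelSet N φ.val 0).powerset)
    (fun φ A => weight N β h (liftConf N φ A).val)]
  rw [← Finset.sum_image (f := fun φ : Conf N => weight N β h φ.val)
    (g := fun p : (_ : Conf N) × Finset (ℤ × ℤ) => liftConf N p.1 p.2)]
  · exact hs.sum_le_tsum _ fun φ _ => (weight_pos N β h φ.val).le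
  · rintro ⟨φ, A⟩ hA ⟨ψ, B⟩ hB hAB
    simp only [Finset.coe_sigma, Set.mem_sigma_iff, Finset.mem_coe,
      Finset.mem_powerset] at hA hB
    obtain ⟨rfl, rfl⟩ := liftConf_injOn hA.2 hB.2 hAB
    rfl

theorem one_lt_exp_neg_add {β h : ℝ} (hβ : 0 < β) (hhw : h < hw β) :
    1 < Real.exp (-h) + Real.exp (-4 * β) := by
  have hE : 1 < Real.exp (4 * β) := Real.one_lt_exp_iff.2 (by linarith)
  have hlt : Real.exp (-hw β) < Real.exp (-h) := Real.exp_lt_exp.2 (by linarith)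
  have hval : Real.exp (-hw β) = 1 - Real.exp (-4 * β) := by
    unfold hw
    rw [Real.exp_neg, Real.exp_log (div_pos (by linarith) (by linarith)), inv_div,
      show -4 * β = -(4 * β) by ring, Real.exp_neg]
    field_simp
  linarith

/-- Lemma 3.1: in the subcritical regime `0 ≤ h < h_w(β)`, the number of zeros is at most
`κ N` with probability at least `1 − e^{−δN}`, where `κ = (4β+δ)/log(e^{−h}+e^{−4β})`. -/
theorem zeros_linear_order (β h δ : ℝ) (N : ℕ)
    (hβ : 1 ≤ β) (hh0 : 0 ≤ h) (hhw : h < hw β) (hδ : 0 < δ) (hN : 1 ≤ N) :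
    prob N β h
        {φ : Conf N |
          (4*β + δ) / Real.log (Real.exp (-h) + Real.exp (-4*β)) * (N:ℝ) ≤
            ((levelSet N φ.val 0).card : ℝ)} ≤
      Real.exp (-δ*(N:ℝ)) := by
  have hβ0 : 0 < β := by linarith
  set q := Real.exp (-h) + Real.exp (-4*β) with hq
  have hq1 : 1 < q := one_lt_exp_neg_add hβ0 hhw
  have hlog : 0 < Real.log q := Real.log_pos hq1
  set E : Set (Conf N) := {φ : Conf N |
    (4*β + δ) / Real.log q * (N:ℝ) ≤ ((levelSet N φ.val 0).card : ℝ)} with hE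
  unfold prob
  by_cases hs : Summable fun φ : Conf N => weight N β h φ.val
  swap
  · rw [show Z N β h = 0 from tsum_eq_zero_of_not_summable hs, div_zero]
    positivity
  have hgain : ∀ φ ∈ E, weight N β h φ.val * Real.exp (δ * N) ≤
      ∑ A ∈ (levelSet N φ.val 0).powerset, weight N β h (liftConf N φ A).val := by
    intro φ hφ
    refine le_trans ?_ (weight_mul_pow_le_sum hβ0.le h φ)
    rw [mul_assoc]
    refine mul_le_mul_of_nonneg_left ?_ (weight_pos N β h φ.val).le
    rw [← hq, ← Real.exp_log (zero_lt_one.trans hq1), ← Real.exp_nat_mul, ← Real.exp_add]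
    refine Real.exp_le_exp.2 ?_
    have hφ' := mul_le_mul_of_nonneg_right (show _ ≤ _ from hφ) hlog.le
    rw [mul_right_comm, div_mul_cancel₀ _ hlog.ne'] at hφ'
    linarith
  have hZ : 0 < Z N β h :=
    hs.tsum_pos (fun φ => (weight_pos N β h φ.val).le)
      ⟨fun _ => 0, fun _ => le_rfl, fun _ _ => rfl⟩ (weight_pos N β h _)
  rw [div_le_iff₀ hZ]
  refine Real.tsum_le_of_sum_le (fun φ => ?_) fun F => ?_
  · split_ifs
    exacts [(weight_pos N β h φ.val).le, le_rfl]
  rw [← Finset.sum_filter]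
  have hF := (Finset.sum_le_sum fun φ hφ => hgain φ (Finset.mem_filter.1 hφ).2).trans
    (sum_liftConf_le_Z hs (F.filter (· ∈ E)))
  rw [← Finset.sum_mul, ← le_div_iff₀ (Real.exp_pos _)] at hF
  refine hF.trans_eq ?_
  rw [neg_mul, Real.exp_neg, div_eq_inv_mul]
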